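/- For every natural number n, (3n)!/((n+1)!·(2n)!) = [∏_{i=0}^{n−1} (1/3+i)/(1/2+i)] · [∏_{i=0}^{n−1} (2/3+i)/(2+i)] · (27/4)ⁿ. -/

import Mathlib

theorem stmt_8 (n : ℕ) :
    ((3 * n).factorial : ℝ) / ((n + 1).factorial * (2 * n).factorial)
      = (∏ i ∈ Finset.range n, (1 / 3 + (i : ℝ)) / (1 / 2 + (i : ℝ))) *
        (∏ i ∈ Finset.range n, (2 / 3 + (i : ℝ)) / (2 + (i : ℝ))) * (27 / 4) ^ n := by
  induction n with
  | zero => simp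
  | succ k ih =>
    rw [Finset.prod_range_succ, Finset.prod_range_succ, pow_succ]
    have e : ∀ a b c d p q : ℝ, a * b * (c * d) * (p * q) = (a * c * p) * (b * d * q) := by
      intros; ring
    rw [e, ← ih, show 3 * (k + 1) = 3 * k + 1 + 1 + 1 by ring,
      show 2 * (k + 1) = 2 * k + 1 + 1 by ring, Nat.factorial_succ (3 * k + 1 + 1),
      Nat.factorial_succ (3 * k + 1), Nat.factorial_succ (3 * k),
      Nat.factorial_succ (2 * k + 1), Nat.factorial_succ (2 * k), Nat.factorial_succ (k + 1)]
    have h1 : ((3 * k).factorial : ℝ) ≠ 0 := by positivity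
    have h2 : ((2 * k).factorial : ℝ) ≠ 0 := by positivity
    have h3 : ((k + 1).factorial : ℝ) ≠ 0 := by positivity
    generalize (3 * k).factorial = A at *
    generalize (2 * k).factorial = B at *
    generalize (k + 1).factorial = C at *
    push_cast
    have p1 : (k : ℝ) + 1 + 1 ≠ 0 := by positivity
    have p2 : 2 * (k : ℝ) + 1 + 1 ≠ 0 := by positivity
    have p3 : 2 * (k : ℝ) + 1 ≠ 0 := by positivity
    have p4 : 1 / 2 + (k : ℝ) ≠ 0 := by positivity
    have p5 : 2 + (k : ℝ) ≠ 0 := by positivity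
    rw [div_mul_div_comm, div_mul_div_comm, div_mul_div_comm, div_eq_div_iff (by positivity) (by positivity)]
    ring
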